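/- arXiv:1907.04370 — 2 statements merged into one kernel-verified Lean document; each statement's English description precedes it below -/
import Mathlib

section
/- Let β > 0 and let ρ₀ be the unique solution of ρ₀ tan ρ₀ = β in (0, π/2). Suppose u : ℝ × [0,1] → ℝ is twice continuously differentiable and satisfies u_{xx} + u_{yy} + ρ₀²u = 0 on ℝ × (0,1), u_y(x,0) = 0 and u_y(x,1) + βu(x,1) = 0 for all x ∈ ℝ, and the growth bound |u(x,y)| ≤ C(1 + |x|) for some constant C and all (x,y). Then there exist A, B ∈ ℝ such that u(x,y) = (A + Bx)·cos(ρ₀y) for all (x,y) ∈ ℝ × [0,1]. -/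
open Real Set

/-- Partial derivative in the first (axial) variable. -/
noncomputable def pdx (u : ℝ × ℝ → ℝ) (p : ℝ × ℝ) : ℝ :=
  deriv (fun t => u (t, p.2)) p.1

/-- Partial derivative in the second (transversal) variable. -/
noncomputable def pdy (u : ℝ × ℝ → ℝ) (p : ℝ × ℝ) : ℝ :=
  deriv (fun t => u (p.1, t)) p.2


lemma ode_liouville (f g g' : ℝ → ℝ) (δ K : ℝ) (hδ : 0 < δ) (hK : 0 ≤ K)
    (hf : ∀ x, HasDerivAt f (2 * g x) x) (hg : ∀ x, HasDerivAt g (g' x) x)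
    (hineq : ∀ x, δ * f x ≤ g' x) (hb : ∀ x, f x ≤ K * (1 + x ^ 2)) (x₀ : ℝ) : f x₀ ≤ 0 := by
  have key : ∀ ε : ℝ, 0 < ε → ∀ x, f x - ε * (x ^ 4 + 9 / δ ^ 2) ≤ 0 := by
    intro ε hε x0
    by_contra! hpos
    set h : ℝ → ℝ := fun x => f x - ε * (x ^ 4 + 9 / δ ^ 2) with hh
    have hd : ∀ x, HasDerivAt h (2 * g x - ε * (4 * x ^ 3)) x := by
      intro x
      have := (hf x).sub ((((hasDerivAt_pow 4 x).add_const (9 / δ ^ 2))).const_mul ε)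
      exact HasDerivAt.congr_deriv this (by norm_num)
    have hdd : ∀ x, HasDerivAt (fun x => 2 * g x - ε * (4 * x ^ 3))
        (2 * g' x - ε * (12 * x ^ 2)) x := by
      intro x
      have := ((hg x).const_mul 2).sub ((((hasDerivAt_pow 3 x).const_mul 4)).const_mul ε)
      exact HasDerivAt.congr_deriv this (by push_cast; ring)
    have hderiv : deriv h = fun x => 2 * g x - ε * (4 * x ^ 3) := funext fun x => (hd x).deriv
    set R : ℝ := 1 + 2 * K / ε + |x0| with hR
    have hKε : 0 ≤ 2 * K / ε := by positivity
    have hR1 : 1 ≤ R := by have := abs_nonneg x0; linarith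
    have hout : ∀ x, x ∉ Icc (-R) R → h x ≤ 0 := by
      intro x hx
      have hx' : R < |x| := by
        by_contra! hc
        exact hx (abs_le.mp hc)
      have h1 : R ≤ x ^ 2 := by
        rw [← sq_abs]; nlinarith
      have h2 : 2 * K ≤ ε * x ^ 2 := by
        have : 2 * K / ε ≤ x ^ 2 := by have := abs_nonneg x0; linarith
        rw [div_le_iff₀ hε] at this; linarith
      have h3 := hb x
      have h4 : 0 ≤ ε * (9 / δ ^ 2) := by positivity
      simp only [hh]
      have h5 : 1 ≤ x ^ 2 := by linarith
      nlinarith [mul_le_mul_of_nonneg_right h2 (sq_nonneg x), mul_le_mul_of_nonneg_left h5 hK]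
    have hcont : Continuous h := continuous_iff_continuousAt.mpr fun x => (hd x).continuousAt
    have hx0R : x0 ∈ Icc (-R) R := by
      refine abs_le.mp ?_
      linarith
    obtain ⟨x1, hx1, hmax⟩ := isCompact_Icc.exists_isMaxOn ⟨x0, hx0R⟩ hcont.continuousOn
    have hp1 : 0 < h x1 := lt_of_lt_of_le hpos (hmax hx0R)
    have hglob : ∀ x, h x ≤ h x1 := by
      intro x
      by_cases hx : x ∈ Icc (-R) R
      · exact hmax hx
      · exact (hout x hx).trans hp1.le
    have hlm : IsLocalMax h x1 := Filter.Eventually.of_forall hglob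
    have hdz : deriv h x1 = 0 := hlm.deriv_eq_zero
    have hddpos : 0 < 2 * g' x1 - ε * (12 * x1 ^ 2) := by
      have h1 := hineq x1
      have h2 : 12 * x1 ^ 2 ≤ 2 * δ * (x1 ^ 4 + 9 / δ ^ 2) := by
        have : 2 * δ * (x1 ^ 4 + 9 / δ ^ 2) - 12 * x1 ^ 2 = 2 * δ * (x1 ^ 2 - 3 / δ) ^ 2 := by
          field_simp; ring
        have h3 : 0 ≤ 2 * δ * (x1 ^ 2 - 3 / δ) ^ 2 := by positivity
        linarith
      have h4 := mul_le_mul_of_nonneg_left h2 hε.le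
      have h5 : 0 < 2 * δ * h x1 := by positivity
      simp only [hh] at h5
      nlinarith
    have hlmin : IsLocalMin h x1 := by
      refine isLocalMin_of_deriv_deriv_pos ?_ hdz hcont.continuousAt
      rw [hderiv, (hdd x1).deriv]; exact hddpos
    have heq : h =ᶠ[nhds x1] fun _ => h x1 := by
      filter_upwards [hlm, hlmin] with x a b using le_antisymm a b
    have h1 : deriv (deriv h) x1 = 0 := by
      rw [(heq.deriv).deriv_eq]; simp
    rw [hderiv, (hdd x1).deriv] at h1
    linarith
  by_contra! hpos
  set ψ := x₀ ^ 4 + 9 / δ ^ 2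
  have hψ : 0 < ψ := by positivity
  have := key (f x₀ / (2 * ψ)) (by positivity) x₀
  have h2 : f x₀ / (2 * ψ) * ψ = f x₀ / 2 := by field_simp
  change f x₀ - f x₀ / (2 * ψ) * ψ ≤ 0 at this
  linarith

lemma diff_int (h hx : ℝ → ℝ → ℝ)
    (hc : ContinuousOn (fun p : ℝ × ℝ => h p.1 p.2) (univ ×ˢ Icc (0:ℝ) 1))
    (hxc : ContinuousOn (fun p : ℝ × ℝ => hx p.1 p.2) (univ ×ˢ Icc (0:ℝ) 1))
    (hd : ∀ x, ∀ y ∈ Icc (0:ℝ) 1, HasDerivAt (fun t => h t y) (hx x y) x) (x : ℝ) :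
    HasDerivAt (fun x => ∫ y in (0:ℝ)..1, h x y) (∫ y in (0:ℝ)..1, hx x y) x := by
  have sl : ∀ k : ℝ → ℝ → ℝ, ContinuousOn (fun p : ℝ × ℝ => k p.1 p.2) (univ ×ˢ Icc (0:ℝ) 1) →
      ∀ t, ContinuousOn (k t) (Icc 0 1) := by
    intro k hk t
    exact hk.comp (f := fun y => (t, y)) (by fun_prop) (fun y hy => ⟨mem_univ _, hy⟩)
  obtain ⟨B, hB⟩ := ((isCompact_Icc (a := x - 1) (b := x + 1)).prod
    (isCompact_Icc (a := (0:ℝ)) (b := 1))).exists_bound_of_continuousOn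
    (hxc.mono (prod_mono (subset_univ _) subset_rfl))
  have hio : Set.uIoc (0:ℝ) 1 ⊆ Icc 0 1 := by
    rw [uIoc_of_le zero_le_one]; exact Ioc_subset_Icc_self
  refine (intervalIntegral.hasDerivAt_integral_of_dominated_loc_of_deriv_le
    (s := Icc (x-1) (x+1)) (bound := fun _ => B)
    (Icc_mem_nhds (by linarith) (by linarith)) ?_ ?_ ?_ ?_ ?_ ?_).2
  · refine Filter.Eventually.of_forall fun t => ?_
    exact ((sl h hc t).mono hio).aestronglyMeasurable measurableSet_uIoc
  · exact ContinuousOn.intervalIntegrable_of_Icc zero_le_one (sl h hc x)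
  · exact ((sl hx hxc x).mono hio).aestronglyMeasurable measurableSet_uIoc
  · refine Filter.Eventually.of_forall fun y hy t ht => ?_
    exact hB (t, y) ⟨ht, hio hy⟩
  · exact intervalIntegrable_const
  · refine Filter.Eventually.of_forall fun y hy t ht => ?_
    exact hd t y (hio hy)

/-- Poincare -/
lemma poinc (v v' φ : ℝ → ℝ) (hv : ContinuousOn v (Icc 0 1)) (hv' : ContinuousOn v' (Icc 0 1))
    (hφ : ContinuousOn φ (Icc 0 1)) (hφ0 : ∀ y ∈ Icc (0:ℝ) 1, 0 < φ y)
    (hd : ∀ y ∈ Ioo (0:ℝ) 1, HasDerivAt v (v' y) y)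
    (h0 : ∫ y in (0:ℝ)..1, v y * φ y = 0) :
    ∫ y in (0:ℝ)..1, v y ^ 2 ≤ 4 * ∫ y in (0:ℝ)..1, v' y ^ 2 := by
  have hz : ∃ y0 ∈ Icc (0:ℝ) 1, v y0 = 0 := by
    by_contra! hne
    have hvφ : ContinuousOn (fun y => v y * φ y) (Icc 0 1) := hv.mul hφ
    have hsign : (∀ y ∈ Icc (0:ℝ) 1, 0 < v y) ∨ (∀ y ∈ Icc (0:ℝ) 1, v y < 0) := by
      by_contra! hc
      obtain ⟨⟨a, ha, hva⟩, ⟨b, hb, hvb⟩⟩ := hc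
      obtain ⟨c, hc, hvc⟩ := isPreconnected_Icc.intermediate_value ha hb hv ⟨hva, hvb⟩
      exact hne c hc hvc
    have h01 : (0:ℝ) ∈ Icc (0:ℝ) 1 := by simp
    rcases hsign with hs | hs
    · have := intervalIntegral.integral_pos zero_lt_one hvφ
        (fun y hy => (mul_pos (hs y (Ioc_subset_Icc_self hy)) (hφ0 y (Ioc_subset_Icc_self hy))).le)
        ⟨0, h01, mul_pos (hs 0 h01) (hφ0 0 h01)⟩
      linarith
    · have := intervalIntegral.integral_pos zero_lt_one hvφ.neg
        (fun y hy => (neg_pos.mpr (mul_neg_of_neg_of_pos (hs y (Ioc_subset_Icc_self hy)) (hφ0 y (Ioc_subset_Icc_self hy)))).le)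
        ⟨0, h01, neg_pos.mpr (mul_neg_of_neg_of_pos (hs 0 h01) (hφ0 0 h01))⟩
      simp only [Pi.neg_apply, intervalIntegral.integral_neg] at this
      linarith
  obtain ⟨y0, hy0, hvy0⟩ := hz
  have i1 : IntervalIntegrable (fun y => v y ^ 2) MeasureTheory.volume 0 1 :=
    ContinuousOn.intervalIntegrable_of_Icc zero_le_one (hv.pow 2)
  have i2 : IntervalIntegrable (fun y => v' y ^ 2) MeasureTheory.volume 0 1 :=
    ContinuousOn.intervalIntegrable_of_Icc zero_le_one (hv'.pow 2)
  have i3 : IntervalIntegrable (fun y => (1/2) * v y ^ 2 + 2 * v' y ^ 2) MeasureTheory.volume 0 1 :=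
    (i1.const_mul _).add (i2.const_mul _)
  have hle : ∀ a b, 0 ≤ a → a ≤ b → b ≤ 1 →
      |v b ^ 2 - v a ^ 2| ≤ ∫ y in (0:ℝ)..1, ((1/2) * v y ^ 2 + 2 * v' y ^ 2) := by
    intro a b ha hab hb
    have hsub : Icc a b ⊆ Icc (0:ℝ) 1 := Icc_subset_Icc ha hb
    have hc2 : ContinuousOn (fun y => 2 * v y * v' y) (Icc a b) :=
      (((continuousOn_const (c := (2:ℝ))).mul hv).mul hv').mono hsub
    have := intervalIntegral.integral_eq_sub_of_hasDerivAt_of_le hab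
      (f := fun y => v y ^ 2) (f' := fun y => 2 * v y * v' y)
      ((hv.pow 2).mono hsub) (fun y hy => by
        have := (hd y ⟨by linarith [hy.1], by linarith [hy.2]⟩).pow 2
        exact HasDerivAt.congr_deriv this (by norm_num)) (ContinuousOn.intervalIntegrable_of_Icc hab hc2)
    rw [← this]
    refine (intervalIntegral.abs_integral_le_integral_abs hab).trans ?_
    have h1 : ∫ y in a..b, |2 * v y * v' y| ≤ ∫ y in a..b, ((1/2) * v y ^ 2 + 2 * v' y ^ 2) := by
      refine intervalIntegral.integral_mono_on hab (ContinuousOn.intervalIntegrable_of_Icc hab hc2.abs)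
        (i3.mono_set ?_) ?_
      · rw [uIcc_of_le hab, uIcc_of_le zero_le_one]; exact hsub
      · intro y hy
        rw [abs_le]
        constructor <;> nlinarith [sq_nonneg (v y + 2 * v' y), sq_nonneg (v y - 2 * v' y)]
    refine h1.trans ?_
    refine intervalIntegral.integral_mono_interval ha hab hb ?_ i3
    exact Filter.Eventually.of_forall fun y => by simp only [Pi.zero_apply]; positivity
  have hpt : ∀ y ∈ Icc (0:ℝ) 1, v y ^ 2 ≤ ∫ y in (0:ℝ)..1, ((1/2) * v y ^ 2 + 2 * v' y ^ 2) := by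
    intro y hy
    rcases le_total y y0 with h | h
    · have := hle y y0 hy.1 h hy0.2
      rw [hvy0, abs_le] at this
      linarith [this.1]
    · have := hle y0 y hy0.1 h hy.2
      rw [hvy0, abs_le] at this
      linarith [this.2]
  have h1 := intervalIntegral.integral_mono_on zero_le_one i1 intervalIntegrable_const hpt
  rw [intervalIntegral.integral_const, intervalIntegral.integral_add (i1.const_mul _) (i2.const_mul _),
    intervalIntegral.integral_const_mul, intervalIntegral.integral_const_mul] at h1
  simp only [sub_zero, one_smul] at h1
  linarith

structure Sol (β ρ : ℝ) (w wx wxx wy : ℝ → ℝ → ℝ) : Prop where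
  cw : ContinuousOn (fun p : ℝ × ℝ => w p.1 p.2) (univ ×ˢ Icc (0:ℝ) 1)
  cwx : ContinuousOn (fun p : ℝ × ℝ => wx p.1 p.2) (univ ×ˢ Icc (0:ℝ) 1)
  cwxx : ContinuousOn (fun p : ℝ × ℝ => wxx p.1 p.2) (univ ×ˢ Icc (0:ℝ) 1)
  cwy : ContinuousOn (fun p : ℝ × ℝ => wy p.1 p.2) (univ ×ˢ Icc (0:ℝ) 1)
  dx : ∀ x, ∀ y ∈ Icc (0:ℝ) 1, HasDerivAt (fun t => w t y) (wx x y) x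
  dxx : ∀ x, ∀ y ∈ Icc (0:ℝ) 1, HasDerivAt (fun t => wx t y) (wxx x y) x
  dy : ∀ x, ∀ y ∈ Ioo (0:ℝ) 1, HasDerivAt (w x) (wy x y) y
  dyy : ∀ x, ∀ y ∈ Ioo (0:ℝ) 1, HasDerivAt (wy x) (- wxx x y - ρ ^ 2 * w x y) y
  b0 : ∀ x, wy x 0 = 0
  b1 : ∀ x, wy x 1 + β * w x 1 = 0

lemma slice_cont {k : ℝ → ℝ → ℝ}
    (hk : ContinuousOn (fun p : ℝ × ℝ => k p.1 p.2) (univ ×ˢ Icc (0:ℝ) 1)) (t : ℝ) :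
    ContinuousOn (k t) (Icc 0 1) :=
  hk.comp (f := fun y => (t, y)) (by fun_prop) (fun y hy => ⟨mem_univ _, hy⟩)

lemma dcos (ρ y : ℝ) : HasDerivAt (fun y => cos (ρ * y)) (-(ρ * sin (ρ * y))) y := by
  have := (Real.hasDerivAt_cos (ρ * y)).comp y ((hasDerivAt_id y).const_mul ρ)
  exact HasDerivAt.congr_deriv this (by simp; ring)

lemma dsin (ρ y : ℝ) : HasDerivAt (fun y => ρ * sin (ρ * y)) (ρ ^ 2 * cos (ρ * y)) y := by
  have := ((Real.hasDerivAt_sin (ρ * y)).comp y ((hasDerivAt_id y).const_mul ρ)).const_mul ρ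
  exact HasDerivAt.congr_deriv this (by simp; ring)

section
variable {β ρ : ℝ} {w wx wxx wy : ℝ → ℝ → ℝ}

lemma dq (h : Sol β ρ w wx wxx wy) (x y : ℝ) (hy : y ∈ Ioo (0:ℝ) 1) :
    HasDerivAt (fun y => cos (ρ * y) * wy x y + ρ * sin (ρ * y) * w x y)
      (- (cos (ρ * y) * wxx x y)) y := by
  have := ((dcos ρ y).mul (h.dyy x y hy)).add ((dsin ρ y).mul (h.dy x y hy))
  exact HasDerivAt.congr_deriv this (by ring)

lemma cq (h : Sol β ρ w wx wxx wy) (x : ℝ) :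
    ContinuousOn (fun y => cos (ρ * y) * wy x y + ρ * sin (ρ * y) * w x y) (Icc 0 1) := by
  have h1 := slice_cont h.cwy x
  have h2 := slice_cont h.cw x
  exact (ContinuousOn.mul (by fun_prop) h1).add (ContinuousOn.mul (by fun_prop) h2)

lemma q1 (hc : 0 < cos ρ) (hβ : ρ * tan ρ = β) (h : Sol β ρ w wx wxx wy) (x : ℝ) :
    cos (ρ * 1) * wy x 1 + ρ * sin (ρ * 1) * w x 1 = 0 := by
  have h1 := h.b1 x
  have h2 : ρ * sin ρ = β * cos ρ := by
    rw [← hβ, mul_assoc, tan_mul_cos hc.ne']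
  rw [mul_one, h2]
  linear_combination cos ρ * h1

lemma q0 (h : Sol β ρ w wx wxx wy) (x : ℝ) :
    cos (ρ * 0) * wy x 0 + ρ * sin (ρ * 0) * w x 0 = 0 := by
  simp [h.b0 x]

lemma moment (hc : 0 < cos ρ) (hβ : ρ * tan ρ = β) (h : Sol β ρ w wx wxx wy) (x : ℝ) :
    ∫ y in (0:ℝ)..1, cos (ρ * y) * wxx x y = 0 := by
  have hcc : ContinuousOn (fun y => - (cos (ρ * y) * wxx x y)) (Icc 0 1) :=
    (ContinuousOn.mul (by fun_prop) (slice_cont h.cwxx x)).neg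
  have := intervalIntegral.integral_eq_sub_of_hasDerivAt_of_le zero_le_one (cq h x)
    (fun y hy => dq h x y hy) (ContinuousOn.intervalIntegrable_of_Icc zero_le_one hcc)
  rw [q1 hc hβ h, q0 h, intervalIntegral.integral_neg] at this
  linarith

lemma cpos (h0 : 0 < ρ) (h1 : ρ < π / 2) (y : ℝ) (hy : y ∈ Icc (0:ℝ) 1) :
    cos ρ ≤ cos (ρ * y) := by
  apply cos_le_cos_of_nonneg_of_le_pi
  · exact mul_nonneg h0.le hy.1
  · linarith [pi_pos]
  · nlinarith [hy.2]

lemma liouville (h0 : 0 < ρ) (h1 : ρ < π / 2) (hβ : ρ * tan ρ = β)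
    (h : Sol β ρ w wx wxx wy) (K : ℝ) (hK : 0 ≤ K)
    (hb : ∀ x, ∀ y ∈ Icc (0:ℝ) 1, w x y ^ 2 ≤ K * (1 + x ^ 2))
    (hm : ∀ x, ∫ y in (0:ℝ)..1, cos (ρ * y) * w x y = 0) :
    ∀ x, ∀ y ∈ Icc (0:ℝ) 1, w x y = 0 := by
  have hc : 0 < cos ρ := cos_pos_of_mem_Ioo ⟨by linarith [pi_pos], h1⟩
  have hcy : ∀ y ∈ Icc (0:ℝ) 1, 0 < cos (ρ * y) := fun y hy => hc.trans_le (cpos h0 h1 y hy)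
  have hccos : ContinuousOn (fun y => cos (ρ * y)) (Icc 0 1) := by fun_prop
  have hf : ∀ x, HasDerivAt (fun x => ∫ y in (0:ℝ)..1, w x y ^ 2)
      (2 * ∫ y in (0:ℝ)..1, w x y * wx x y) x := by
    intro x
    rw [← intervalIntegral.integral_const_mul]
    refine diff_int (fun x y => w x y ^ 2) (fun x y => 2 * (w x y * wx x y)) (h.cw.pow 2)
      ((h.cw.mul h.cwx).const_smul (2:ℝ)) (fun x y hy => ?_) x
    exact HasDerivAt.congr_deriv ((h.dx x y hy).pow 2) (by norm_num; ring)
  have hg : ∀ x, HasDerivAt (fun x => ∫ y in (0:ℝ)..1, w x y * wx x y)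
      (∫ y in (0:ℝ)..1, (wx x y ^ 2 + w x y * wxx x y)) x := by
    intro x
    refine diff_int (fun x y => w x y * wx x y) (fun x y => wx x y ^ 2 + w x y * wxx x y)
      (h.cw.mul h.cwx) ((h.cwx.pow 2).add (h.cw.mul h.cwxx)) (fun x y hy => ?_) x
    exact HasDerivAt.congr_deriv ((h.dx x y hy).mul (h.dxx x y hy)) (by ring)
  have hineq : ∀ x, (cos ρ ^ 2 / 4) * (∫ y in (0:ℝ)..1, w x y ^ 2) ≤
      ∫ y in (0:ℝ)..1, (wx x y ^ 2 + w x y * wxx x y) := by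
    intro x
    have sw := slice_cont h.cw x
    have swx := slice_cont h.cwx x
    have swxx := slice_cont h.cwxx x
    set q : ℝ → ℝ := fun y => cos (ρ * y) * wy x y + ρ * sin (ρ * y) * w x y with hq
    have cq' : ContinuousOn q (Icc 0 1) := cq h x
    set v : ℝ → ℝ := fun y => w x y / cos (ρ * y) with hv
    set v' : ℝ → ℝ := fun y => q y / cos (ρ * y) ^ 2 with hv'
    have cv : ContinuousOn v (Icc 0 1) := sw.div hccos (fun y hy => (hcy y hy).ne')
    have cv' : ContinuousOn v' (Icc 0 1) :=
      cq'.div (hccos.pow 2) (fun y hy => (pow_pos (hcy y hy) 2).ne')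
    have dv : ∀ y ∈ Ioo (0:ℝ) 1, HasDerivAt v (v' y) y := by
      intro y hy
      have hp := hcy y (Ioo_subset_Icc_self hy)
      refine HasDerivAt.congr_deriv (HasDerivAt.div (h.dy x y hy) (dcos ρ y) hp.ne') ?_
      simp only [hv', hq]
      congr 1; ring
    have hvm : ∫ y in (0:ℝ)..1, v y * cos (ρ * y) ^ 2 = 0 := by
      refine Eq.trans ?_ (hm x)
      refine intervalIntegral.integral_congr fun y hy => ?_
      rw [uIcc_of_le zero_le_one] at hy
      have hp := hcy y hy
      simp only [hv]; field_simp
    have P := poinc v v' (fun y => cos (ρ * y) ^ 2) cv cv' (hccos.pow 2)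
      (fun y hy => pow_pos (hcy y hy) 2) dv hvm
    have cE : ContinuousOn (fun y => cos (ρ * y) ^ 2 * v' y ^ 2) (Icc 0 1) :=
      (hccos.pow 2).mul (cv'.pow 2)
    have ii : ∀ {k : ℝ → ℝ}, ContinuousOn k (Icc 0 1) →
      IntervalIntegrable k MeasureTheory.volume 0 1 :=
      fun hk => ContinuousOn.intervalIntegrable_of_Icc zero_le_one hk
    have I1 : ∫ y in (0:ℝ)..1, w x y ^ 2 ≤ ∫ y in (0:ℝ)..1, v y ^ 2 := by
      refine intervalIntegral.integral_mono_on zero_le_one (ii (sw.pow 2)) (ii (cv.pow 2)) ?_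
      intro y hy
      have hp := hcy y hy
      have e : w x y = v y * cos (ρ * y) := by simp only [hv]; field_simp
      rw [e, mul_pow]
      have := cos_sq_le_one (ρ * y)
      nlinarith [sq_nonneg (v y)]
    have I2 : cos ρ ^ 2 * ∫ y in (0:ℝ)..1, v' y ^ 2 ≤
        ∫ y in (0:ℝ)..1, cos (ρ * y) ^ 2 * v' y ^ 2 := by
      rw [← intervalIntegral.integral_const_mul]
      refine intervalIntegral.integral_mono_on zero_le_one ((ii (cv'.pow 2)).const_mul _) (ii cE) ?_
      intro y hy
      have := pow_le_pow_left₀ hc.le (cpos h0 h1 y hy) 2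
      nlinarith [sq_nonneg (v' y)]
    have cR : ContinuousOn (fun y => cos (ρ * y) ^ 2 * v' y ^ 2 - w x y * wxx x y) (Icc 0 1) :=
      cE.sub (sw.mul swxx)
    have I3 : ∫ y in (0:ℝ)..1, (cos (ρ * y) ^ 2 * v' y ^ 2 - w x y * wxx x y) = 0 := by
      have := intervalIntegral.integral_eq_sub_of_hasDerivAt_of_le zero_le_one
        (f := fun y => v y * q y)
        (f' := fun y => cos (ρ * y) ^ 2 * v' y ^ 2 - w x y * wxx x y) (cv.mul cq')
        (fun y hy => by
          have hp := hcy y (Ioo_subset_Icc_self hy)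
          refine HasDerivAt.congr_deriv ((dv y hy).mul (dq h x y hy)) ?_
          simp only [hv, hv']
          field_simp
          simp only [hq]
          ring) (ii cR)
      rw [this]
      have e1 : q 1 = 0 := q1 hc hβ h x
      have e0 : q 0 = 0 := q0 h x
      simp [e1, e0]
    have cP : ContinuousOn (fun y => w x y * wxx x y) (Icc 0 1) := sw.mul swxx
    have cQ : ContinuousOn (fun y => wx x y ^ 2) (Icc 0 1) := swx.pow 2
    rw [intervalIntegral.integral_sub (ii cE) (ii cP)] at I3
    rw [intervalIntegral.integral_add (ii cQ) (ii cP)]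
    have I4 : 0 ≤ ∫ y in (0:ℝ)..1, wx x y ^ 2 :=
      intervalIntegral.integral_nonneg zero_le_one fun y _ => sq_nonneg _
    have hc2 : 0 < cos ρ ^ 2 := by positivity
    have := mul_le_mul_of_nonneg_left (I1.trans P) hc2.le
    linarith
  have hfb : ∀ x, ∫ y in (0:ℝ)..1, w x y ^ 2 ≤ K * (1 + x ^ 2) := by
    intro x
    have := intervalIntegral.integral_mono_on zero_le_one
      (ContinuousOn.intervalIntegrable_of_Icc (μ := MeasureTheory.volume) zero_le_one ((slice_cont h.cw x).pow 2))
      intervalIntegrable_const (hb x)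
    simpa using this
  intro x y hy
  by_contra hne
  have h3 := ode_liouville _ _ _ (cos ρ ^ 2 / 4) K (by positivity) hK hf hg hineq hfb x
  have h4 := intervalIntegral.integral_pos zero_lt_one ((slice_cont h.cw x).pow 2)
    (fun y _ => sq_nonneg _) ⟨y, hy, sq_pos_of_ne_zero hne⟩
  simp only [Pi.pow_apply] at h4
  linarith

lemma Sol.shift (hc : 0 < cos ρ) (hβ : ρ * tan ρ = β) (h : Sol β ρ w wx wxx wy) (A B : ℝ) :
    Sol β ρ (fun x y => w x y - (A + B * x) * cos (ρ * y)) (fun x y => wx x y - B * cos (ρ * y))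
      wxx (fun x y => wy x y + (A + B * x) * (ρ * sin (ρ * y))) where
  cw := h.cw.sub (by fun_prop)
  cwx := h.cwx.sub (by fun_prop)
  cwxx := h.cwxx
  cwy := h.cwy.add (by fun_prop)
  dx := fun x y hy => by
    refine HasDerivAt.congr_deriv ((h.dx x y hy).sub
      ((((hasDerivAt_id x).const_mul B).const_add A).mul_const (cos (ρ * y)))) (by simp)
  dxx := fun x y hy => (h.dxx x y hy).sub_const _
  dy := fun x y hy => HasDerivAt.congr_deriv
      ((h.dy x y hy).sub ((dcos ρ y).const_mul (A + B * x))) (by ring)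
  dyy := fun x y hy => HasDerivAt.congr_deriv
      ((h.dyy x y hy).add ((dsin ρ y).const_mul (A + B * x))) (by ring)
  b0 := fun x => by simp [h.b0 x]
  b1 := fun x => by
    have h1 := h.b1 x
    have h2 : ρ * sin ρ = β * cos ρ := by
      rw [← hβ, mul_assoc, tan_mul_cos hc.ne']
    simp only [mul_one]
    linear_combination h1 + (A + B * x) * h2

lemma main_abs (h0 : 0 < ρ) (h1 : ρ < π / 2) (hβ : ρ * tan ρ = β)
    (h : Sol β ρ w wx wxx wy) (C : ℝ)
    (hb : ∀ x, ∀ y ∈ Icc (0:ℝ) 1, |w x y| ≤ C * (1 + |x|)) :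
    ∃ A B : ℝ, ∀ x, ∀ y ∈ Icc (0:ℝ) 1, w x y = (A + B * x) * cos (ρ * y) := by
  have hc : 0 < cos ρ := cos_pos_of_mem_Ioo ⟨by linarith [pi_pos], h1⟩
  have hcy : ∀ y ∈ Icc (0:ℝ) 1, 0 < cos (ρ * y) := fun y hy => hc.trans_le (cpos h0 h1 y hy)
  have hcc : ContinuousOn (fun p : ℝ × ℝ => cos (ρ * p.2)) (univ ×ˢ Icc (0:ℝ) 1) := by fun_prop
  have M1 : ∀ x, HasDerivAt (fun x => ∫ y in (0:ℝ)..1, cos (ρ * y) * w x y)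
      (∫ y in (0:ℝ)..1, cos (ρ * y) * wx x y) x := fun x =>
    diff_int (fun x y => cos (ρ * y) * w x y) (fun x y => cos (ρ * y) * wx x y)
      (hcc.mul h.cw) (hcc.mul h.cwx) (fun x y hy => (h.dx x y hy).const_mul _) x
  have M2 : ∀ x, HasDerivAt (fun x => ∫ y in (0:ℝ)..1, cos (ρ * y) * wx x y) 0 x := fun x => by
    refine HasDerivAt.congr_deriv ?_ (moment hc hβ h x)
    exact diff_int (fun x y => cos (ρ * y) * wx x y) (fun x y => cos (ρ * y) * wxx x y)
      (hcc.mul h.cwx) (hcc.mul h.cwxx) (fun x y hy => (h.dxx x y hy).const_mul _) x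
  set m : ℝ := ∫ y in (0:ℝ)..1, cos (ρ * y) ^ 2 with hm
  have hmpos : 0 < m := intervalIntegral.integral_pos zero_lt_one (by fun_prop)
    (fun y _ => sq_nonneg _) ⟨0, by simp, by simp⟩
  set M : ℝ → ℝ := fun x => ∫ y in (0:ℝ)..1, cos (ρ * y) * w x y with hM
  set N : ℝ → ℝ := fun x => ∫ y in (0:ℝ)..1, cos (ρ * y) * wx x y with hN
  have N0 : ∀ x, N x = N 0 := fun x =>
    is_const_of_deriv_eq_zero (fun x => (M2 x).differentiableAt) (fun x => (M2 x).deriv) x 0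
  have M0 : ∀ x, M x = M 0 + N 0 * x := by
    intro x
    have hd : ∀ x, HasDerivAt (fun x => M x - N 0 * x) 0 x := fun x =>
      HasDerivAt.congr_deriv ((M1 x).sub ((hasDerivAt_id x).const_mul (N 0)))
        (by have := N0 x; simp only [hN] at this ⊢; simp [this])
    have := is_const_of_deriv_eq_zero (fun x => (hd x).differentiableAt) (fun x => (hd x).deriv) x 0
    simp only [mul_zero, sub_zero] at this
    linarith
  refine ⟨M 0 / m, N 0 / m, ?_⟩
  set A := M 0 / m with hA
  set B := N 0 / m with hB
  have hs := h.shift hc hβ A B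
  have hC : 0 ≤ C := by
    have := (abs_nonneg _).trans (hb 0 0 (by simp))
    simpa using this
  set D := C + |A| + |B| with hD
  have hD0 : 0 ≤ D := by positivity
  have key := liouville h0 h1 hβ hs (2 * D ^ 2) (by positivity) ?_ ?_
  · intro x y hy
    have := key x y hy
    linarith
  · intro x y hy
    have e1 : |w x y - (A + B * x) * cos (ρ * y)| ≤ D * (1 + |x|) := by
      have a1 := hb x y hy
      have a2 : |(A + B * x) * cos (ρ * y)| ≤ |A| + |B| * |x| := by
        rw [abs_mul, ← abs_mul B x]
        refine (mul_le_of_le_one_right (abs_nonneg _) (abs_cos_le_one _)).trans (abs_add_le _ _)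
      have a3 := abs_sub (w x y) ((A + B * x) * cos (ρ * y))
      have := abs_nonneg x
      have := abs_nonneg A
      have := abs_nonneg B
      have : 0 ≤ |A| * |x| := by positivity
      simp only [hD]
      nlinarith
    have e2 := pow_le_pow_left₀ (abs_nonneg _) e1 2
    rw [sq_abs] at e2
    refine e2.trans ?_
    have e3 : (1 + |x|) ^ 2 ≤ 2 * (1 + x ^ 2) := by
      have := sq_abs x
      nlinarith [sq_nonneg (1 - |x|)]
    have := mul_le_mul_of_nonneg_left e3 (sq_nonneg D)
    nlinarith
  · intro x
    have i1 : IntervalIntegrable (fun y => cos (ρ * y) * w x y) MeasureTheory.volume 0 1 :=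
      ContinuousOn.intervalIntegrable_of_Icc zero_le_one
        (ContinuousOn.mul (by fun_prop) (slice_cont h.cw x))
    have i2 : IntervalIntegrable (fun y => cos (ρ * y) ^ 2) MeasureTheory.volume 0 1 :=
      Continuous.intervalIntegrable (by fun_prop) _ _
    have e : ∀ y, cos (ρ * y) * (w x y - (A + B * x) * cos (ρ * y)) =
        cos (ρ * y) * w x y - (A + B * x) * cos (ρ * y) ^ 2 := fun y => by ring
    simp only [e]
    rw [intervalIntegral.integral_sub i1 (i2.const_mul _), intervalIntegral.integral_const_mul]
    have := M0 x
    simp only [hM] at this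
    rw [this, ← hm]
    simp only [hA, hB, hM]
    field_simp
    ring
end

lemma part_x (k : ℝ × ℝ → ℝ) (hk : DifferentiableOn ℝ k (univ ×ˢ Icc (0:ℝ) 1)) (x y : ℝ)
    (hy : y ∈ Icc (0:ℝ) 1) :
    HasDerivAt (fun t => k (t, y)) (fderivWithin ℝ k (univ ×ˢ Icc (0:ℝ) 1) (x, y) (1, 0)) x := by
  have h1 := (hk (x, y) ⟨mem_univ _, hy⟩).hasFDerivWithinAt
  have h2 : HasDerivWithinAt (fun t : ℝ => (t, y)) ((1:ℝ), (0:ℝ)) univ x :=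
    ((hasDerivAt_id x).prodMk (hasDerivAt_const x y)).hasDerivWithinAt
  have := h1.comp_hasDerivWithinAt x h2
    (show MapsTo (fun t : ℝ => (t, y)) univ (univ ×ˢ Icc (0:ℝ) 1) from
      fun t _ => ⟨mem_univ _, hy⟩)
  exact hasDerivWithinAt_univ.mp this

lemma part_y (k : ℝ × ℝ → ℝ) (hk : DifferentiableOn ℝ k (univ ×ˢ Icc (0:ℝ) 1)) (x y : ℝ)
    (hy : y ∈ Icc (0:ℝ) 1) :
    HasDerivWithinAt (fun t => k (x, t)) (fderivWithin ℝ k (univ ×ˢ Icc (0:ℝ) 1) (x, y) (0, 1))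
      (Icc 0 1) y := by
  have h1 := (hk (x, y) ⟨mem_univ _, hy⟩).hasFDerivWithinAt
  have h2 : HasDerivWithinAt (fun t : ℝ => (x, t)) ((0:ℝ), (1:ℝ)) (Icc 0 1) y :=
    ((hasDerivAt_const y x).prodMk (hasDerivAt_id y)).hasDerivWithinAt
  exact h1.comp_hasDerivWithinAt y h2 (fun t ht => ⟨mem_univ _, ht⟩)

/-- Kernel characterization for the linearized Fisher--KPP operator `L = Δ + ρ₀²`
on the strip `ℝ × [0,1]`: every polynomially bounded solution with the Robin-type
boundary conditions is of the form `(A + Bx) cos(ρ₀ y)`. -/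
theorem fkpp_kernel_characterization (β ρ₀ : ℝ) (hβ : 0 < β)
    (hρ₀ : ρ₀ ∈ Ioo (0 : ℝ) (π / 2)) (hρ₀β : ρ₀ * Real.tan ρ₀ = β)
    (u : ℝ × ℝ → ℝ) (C : ℝ)
    (hreg : ContDiffOn ℝ 2 u (univ ×ˢ Icc (0 : ℝ) 1))
    (hpde : ∀ x : ℝ, ∀ y ∈ Ioo (0 : ℝ) 1,
      pdx (pdx u) (x, y) + pdy (pdy u) (x, y) + ρ₀ ^ 2 * u (x, y) = 0)
    (hbc0 : ∀ x : ℝ, derivWithin (fun t => u (x, t)) (Icc 0 1) 0 = 0)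
    (hbc1 : ∀ x : ℝ, derivWithin (fun t => u (x, t)) (Icc 0 1) 1 + β * u (x, 1) = 0)
    (hgrowth : ∀ x : ℝ, ∀ y ∈ Icc (0 : ℝ) 1, |u (x, y)| ≤ C * (1 + |x|)) :
    ∃ A B : ℝ, ∀ x : ℝ, ∀ y ∈ Icc (0 : ℝ) 1,
      u (x, y) = (A + B * x) * Real.cos (ρ₀ * y) := by
  set S : Set (ℝ × ℝ) := univ ×ˢ Icc (0 : ℝ) 1 with hS
  have hU1 : UniqueDiffOn ℝ (Icc (0:ℝ) 1) := uniqueDiffOn_Icc zero_lt_one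
  have hU : UniqueDiffOn ℝ S := uniqueDiffOn_univ.prod hU1
  have hF : ContDiffOn ℝ 1 (fderivWithin ℝ u S) S := hreg.fderivWithin hU (by norm_num)
  have hux : ContDiffOn ℝ 1 (fun p => fderivWithin ℝ u S p (1, 0)) S :=
    hF.clm_apply contDiffOn_const
  have huy : ContDiffOn ℝ 1 (fun p => fderivWithin ℝ u S p (0, 1)) S :=
    hF.clm_apply contDiffOn_const
  set ux : ℝ × ℝ → ℝ := fun p => fderivWithin ℝ u S p (1, 0) with hux'
  set uy : ℝ × ℝ → ℝ := fun p => fderivWithin ℝ u S p (0, 1) with huy'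
  have hud : DifferentiableOn ℝ u S := hreg.differentiableOn (by norm_num)
  have huxd : DifferentiableOn ℝ ux S := hux.differentiableOn (by norm_num)
  have huyd : DifferentiableOn ℝ uy S := huy.differentiableOn (by norm_num)
  have huxx : ContinuousOn (fun p => fderivWithin ℝ ux S p (1, 0)) S :=
    (hux.continuousOn_fderivWithin hU (by norm_num)).clm_apply continuousOn_const
  have hyI : ∀ x, ∀ y ∈ Ioo (0:ℝ) 1, HasDerivAt (fun t => u (x, t)) (uy (x, y)) y :=
    fun x y hy => (part_y u hud x y (Ioo_subset_Icc_self hy)).hasDerivAt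
      (Icc_mem_nhds hy.1 hy.2)
  have hyyI : ∀ x, ∀ y ∈ Ioo (0:ℝ) 1, HasDerivAt (fun t => uy (x, t))
      (fderivWithin ℝ uy S (x, y) (0, 1)) y :=
    fun x y hy => (part_y uy huyd x y (Ioo_subset_Icc_self hy)).hasDerivAt
      (Icc_mem_nhds hy.1 hy.2)
  have hxx : ∀ x, ∀ y ∈ Icc (0:ℝ) 1, pdx (pdx u) (x, y) = fderivWithin ℝ ux S (x, y) (1, 0) := by
    intro x y hy
    have e : (fun t => pdx u (t, y)) = fun t => ux (t, y) :=
      funext fun t => (part_x u hud t y hy).deriv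
    change deriv (fun t => pdx u (t, y)) x = _
    rw [e]
    exact (part_x ux huxd x y hy).deriv
  have hyy : ∀ x, ∀ y ∈ Ioo (0:ℝ) 1, pdy (pdy u) (x, y) = fderivWithin ℝ uy S (x, y) (0, 1) := by
    intro x y hy
    have e : (fun t => pdy u (x, t)) =ᶠ[nhds y] fun t => uy (x, t) := by
      filter_upwards [isOpen_Ioo.mem_nhds hy] with t ht
      exact (hyI x t ht).deriv
    change deriv (fun t => pdy u (x, t)) y = _
    rw [e.deriv_eq]
    exact (hyyI x y hy).deriv
  have hsol : Sol β ρ₀ (fun x y => u (x, y)) (fun x y => ux (x, y))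
      (fun x y => fderivWithin ℝ ux S (x, y) (1, 0)) (fun x y => uy (x, y)) :=
    { cw := hreg.continuousOn
      cwx := hux.continuousOn
      cwxx := huxx
      cwy := huy.continuousOn
      dx := fun x y hy => part_x u hud x y hy
      dxx := fun x y hy => part_x ux huxd x y hy
      dy := hyI
      dyy := fun x y hy => by
        refine HasDerivAt.congr_deriv (hyyI x y hy) ?_
        have := hpde x y hy
        rw [hxx x y (Ioo_subset_Icc_self hy), hyy x y hy] at this
        linarith
      b0 := fun x => by
        refine Eq.trans ?_ (hbc0 x)
        exact ((part_y u hud x 0 (by simp)).derivWithin (hU1 0 (by simp))).symm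
      b1 := fun x => by
        rw [← hbc1 x, (part_y u hud x 1 (by simp)).derivWithin (hU1 1 (by simp))] }
  exact main_abs hρ₀.1 hρ₀.2 hρ₀β hsol C hgrowth
end

section
/- Let β > 0, let ρ₀ be the unique solution of ρ₀ tan ρ₀ = β in (0, π/2), and let c₂ ∈ ℝ. Then there exists a twice continuously differentiable function g : [0,1] → ℝ satisfying g''(y) + ρ₀²g(y) + c₂·cos(ρ₀y) = cos²(ρ₀y) for all y ∈ [0,1], g'(0) = 0, and g'(1) + βg(1) = 0, if and only if c₂ = 4 sin(ρ₀)(3 − sin²ρ₀)/(3(2ρ₀ + sin 2ρ₀)). Moreover, when this holds there is exactly one such g with g(0) = 0. -/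
open Real Set

/-- The boundary value problem arising in the computation of the quadratic
coefficient `Ψ₂₀₀` of the Fisher--KPP center manifold reduction:
`g'' + ρ₀²g + c₂ cos(ρ₀ y) = cos²(ρ₀ y)` on `[0,1]`, `g'(0) = 0`,
`g'(1) + βg(1) = 0`. -/
def IsSolBVP (β ρ₀ c₂ : ℝ) (g : ℝ → ℝ) : Prop :=
  ContDiffOn ℝ 2 g (Icc 0 1) ∧
  (∀ y ∈ Icc (0 : ℝ) 1,
    derivWithin (derivWithin g (Icc 0 1)) (Icc 0 1) y + ρ₀ ^ 2 * g y
      + c₂ * Real.cos (ρ₀ * y) = (Real.cos (ρ₀ * y)) ^ 2) ∧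
  derivWithin g (Icc 0 1) 0 = 0 ∧
  derivWithin g (Icc 0 1) 1 + β * g 1 = 0

lemma const_aux (f : ℝ → ℝ) (hf : ∀ y ∈ Icc (0:ℝ) 1, HasDerivWithinAt f 0 (Icc 0 1) y) :
    ∀ y ∈ Icc (0:ℝ) 1, f y = f 0 := by
  intro y hy
  refine (convex_Icc (0:ℝ) 1).is_const_of_fderivWithin_eq_zero (𝕜 := ℝ)
    (fun x hx => (hf x hx).differentiableWithinAt) ?_ hy (by simp)
  intro x hx
  have h := (hf x hx).hasFDerivWithinAt.fderivWithin (uniqueDiffOn_Icc one_pos x hx)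
  rw [h]; ext; simp

lemma ode_aux (r c : ℝ) (hr : r ≠ 0) (g g1 : ℝ → ℝ)
    (h1 : ∀ y ∈ Icc (0:ℝ) 1, HasDerivWithinAt g (g1 y) (Icc 0 1) y)
    (h2 : ∀ y ∈ Icc (0:ℝ) 1, HasDerivWithinAt g1
      (cos (r*y)^2 - c * cos (r*y) - r^2 * g y) (Icc 0 1) y)
    (h0 : g1 0 = 0) : ∀ y ∈ Icc (0:ℝ) 1,
    g1 y * cos (r*y) + r * g y * sin (r*y) = sin (r*y)/r - sin (r*y)^3/(3*r)
      - c * (y/2 + sin (r*y) * cos (r*y)/(2*r)) ∧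
    g1 y * sin (r*y) - r * g y * cos (r*y) = -cos (r*y)^3/(3*r) - c * sin (r*y)^2/(2*r)
      + 1/(3*r) - r * g 0 := by
  have hl : ∀ y, HasDerivWithinAt (fun y => r*y) r (Icc 0 1) y := fun y => by
    simpa using ((hasDerivAt_id y).const_mul r).hasDerivWithinAt
  intro y hy
  constructor
  · have := const_aux (fun y => g1 y * cos (r*y) + r * g y * sin (r*y) - (sin (r*y)/r
      - sin (r*y)^3/(3*r) - c * (y/2 + sin (r*y) * cos (r*y)/(2*r)))) (fun x hx => by
        have hs := (hl x).sin
        have hc := (hl x).cos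
        refine ((((h2 x hx).mul hc).add (((h1 x hx).const_mul r).mul hs)).sub
          (((hs.div_const r).sub ((hs.pow 3).div_const (3*r))).sub
          ((((hasDerivWithinAt_id x _).div_const 2).add
            ((hs.mul hc).div_const (2*r))).const_mul c))).congr_deriv ?_
        have e := sin_sq_add_cos_sq (r*x)
        have e' : sin (r*x)^2 = 1 - cos (r*x)^2 := by linarith
        field_simp
        push_cast
        ring_nf
        simp only [e']
        ring) y hy
    simp [h0] at this
    linarith
  · have := const_aux (fun y => g1 y * sin (r*y) - r * g y * cos (r*y)
      - (-cos (r*y)^3/(3*r) - c * sin (r*y)^2/(2*r))) (fun x hx => by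
        have hs := (hl x).sin
        have hc := (hl x).cos
        refine ((((h2 x hx).mul hs).sub (((h1 x hx).const_mul r).mul hc)).sub
          (((hc.pow 3).neg.div_const (3*r)).sub
          (((hs.pow 2).const_mul c).div_const (2*r)))).congr_deriv ?_
        field_simp
        push_cast
        ring) y hy
    simp [h0] at this
    have e : 1/(3*r) = r⁻¹ * 3⁻¹ := by field_simp
    have e2 : (-1)/(3*r) = -(r⁻¹ * 3⁻¹) := by field_simp
    rw [e]
    try rw [e2] at this
    linarith

lemma sol_aux {β r c : ℝ} {g : ℝ → ℝ} (h : IsSolBVP β r c g) :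
    (∀ y ∈ Icc (0:ℝ) 1, HasDerivWithinAt g (derivWithin g (Icc 0 1) y) (Icc 0 1) y) ∧
    (∀ y ∈ Icc (0:ℝ) 1, HasDerivWithinAt (derivWithin g (Icc 0 1))
      (cos (r*y)^2 - c * cos (r*y) - r^2 * g y) (Icc 0 1) y) := by
  obtain ⟨hc, ho, -, -⟩ := h
  refine ⟨fun y hy => ((hc.differentiableOn (by norm_num)) y hy).hasDerivWithinAt,
    fun y hy => ?_⟩
  have hd := hc.derivWithin (m := 1) (uniqueDiffOn_Icc one_pos) (by norm_num)
  refine ((hd.differentiableOn (by norm_num)) y hy).hasDerivWithinAt.congr_deriv ?_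
  linarith [ho y hy]

lemma fkpp_iff (r c : ℝ) (hr : 0 < r) (hd : 0 < 2 * r + sin (2*r)) :
    c = 4 * sin r * (3 - (sin r) ^ 2) / (3 * (2 * r + sin (2 * r))) ↔
    sin r/r - sin r^3/(3*r) - c * (1/2 + sin r * cos r/(2*r)) = 0 := by
  rw [eq_div_iff (by positivity), sin_two_mul]
  have : sin r/r - sin r^3/(3*r) - c * (1/2 + sin r * cos r/(2*r)) =
    (4 * sin r * (3 - sin r^2) - c * (3 * (2*r + 2 * sin r * cos r))) / (12 * r) := by
    field_simp
    ring
  rw [this, div_eq_zero_iff]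
  constructor
  · intro h; left; linarith
  · rintro (h | h)
    · linarith
    · linarith

lemma fkpp_exists (r c : ℝ) (hr : r ≠ 0) : ∃ g g1 : ℝ → ℝ,
    ContDiff ℝ 2 g ∧ (∀ y, HasDerivAt g (g1 y) y) ∧
    (∀ y, HasDerivAt g1 (cos (r*y)^2 - c * cos (r*y) - r^2 * g y) y) ∧ g1 0 = 0 ∧ g 0 = 0 := by
  refine ⟨fun y => 2/(3*r^2) - cos (r*y)^2/(3*r^2) - c * (y * sin (r*y))/(2*r)
      - cos (r*y)/(3*r^2),
    fun y => 2 * cos (r*y) * sin (r*y)/(3*r) - c * (sin (r*y) + r * (y * cos (r*y)))/(2*r)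
      + sin (r*y)/(3*r), by fun_prop, fun y => ?_, fun y => ?_, by simp, ?_⟩
  · have hl : HasDerivAt (fun y => r*y) r y := by
      simpa using ((hasDerivAt_id y).const_mul r)
    have hs := hl.sin
    have hc := hl.cos
    refine (((((hc.pow 2).div_const (3*r^2)).const_sub (2/(3*r^2))).sub
      ((((hasDerivAt_id y).mul hs).const_mul c).div_const (2*r))).sub
      (hc.div_const (3*r^2))).congr_deriv ?_
    simp only [id]
    field_simp
    push_cast
    ring
  · have hl : HasDerivAt (fun y => r*y) r y := by
      simpa using ((hasDerivAt_id y).const_mul r)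
    have hs := hl.sin
    have hc := hl.cos
    refine (((((hc.const_mul 2).mul hs).div_const (3*r)).sub
      (((hs.add (((hasDerivAt_id y).mul hc).const_mul r)).const_mul c).div_const (2*r))).add
      (hs.div_const (3*r))).congr_deriv ?_
    have e' : sin (r*y)^2 = 1 - cos (r*y)^2 := by linarith [sin_sq_add_cos_sq (r*y)]
    simp only [id]
    field_simp
    ring_nf
    simp only [e']
    ring
  · simp; field_simp; norm_num

/-- Solvability of the `Ψ₂₀₀` boundary value problem holds iff `c₂` takes the
specific value `4 sin(ρ₀)(3 − sin²ρ₀)/(3(2ρ₀ + sin 2ρ₀))`; in that case there is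
exactly one solution with `g(0) = 0`. -/
theorem fkpp_psi200_bvp (β ρ₀ c₂ : ℝ) (hβ : 0 < β)
    (hρ₀ : ρ₀ ∈ Ioo (0 : ℝ) (π / 2)) (hρ₀β : ρ₀ * Real.tan ρ₀ = β) :
    ((∃ g : ℝ → ℝ, IsSolBVP β ρ₀ c₂ g) ↔
      c₂ = 4 * Real.sin ρ₀ * (3 - (Real.sin ρ₀) ^ 2)
        / (3 * (2 * ρ₀ + Real.sin (2 * ρ₀)))) ∧
    (c₂ = 4 * Real.sin ρ₀ * (3 - (Real.sin ρ₀) ^ 2)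
        / (3 * (2 * ρ₀ + Real.sin (2 * ρ₀))) →
      (∃ g : ℝ → ℝ, IsSolBVP β ρ₀ c₂ g ∧ g 0 = 0) ∧
      (∀ g₁ g₂ : ℝ → ℝ, IsSolBVP β ρ₀ c₂ g₁ → IsSolBVP β ρ₀ c₂ g₂ →
        g₁ 0 = 0 → g₂ 0 = 0 → ∀ y ∈ Icc (0 : ℝ) 1, g₁ y = g₂ y)) := by
  obtain ⟨hr, hr2⟩ := hρ₀
  have hcos : 0 < cos ρ₀ := cos_pos_of_mem_Ioo ⟨by linarith, hr2⟩
  have hd : 0 < 2 * ρ₀ + sin (2*ρ₀) := by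
    have := sin_pos_of_pos_of_lt_pi (x := 2*ρ₀) (by linarith) (by linarith)
    linarith
  have hb : β * cos ρ₀ = ρ₀ * sin ρ₀ := by
    rw [← hρ₀β, tan_eq_sin_div_cos]; field_simp
  rw [fkpp_iff ρ₀ c₂ hr hd]
  have hex : sin ρ₀/ρ₀ - sin ρ₀^3/(3*ρ₀) - c₂ * (1/2 + sin ρ₀ * cos ρ₀/(2*ρ₀)) = 0 →
      ∃ g : ℝ → ℝ, IsSolBVP β ρ₀ c₂ g ∧ g 0 = 0 := by
    intro hF
    obtain ⟨g, g1, hg, h1, h2, h10, h00⟩ := fkpp_exists ρ₀ c₂ hr.ne'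
    have hu := uniqueDiffOn_Icc (zero_lt_one (α := ℝ))
    have e1 : ∀ y ∈ Icc (0:ℝ) 1, derivWithin g (Icc 0 1) y = g1 y := fun y hy =>
      (h1 y).hasDerivWithinAt.derivWithin (hu y hy)
    refine ⟨g, ⟨hg.contDiffOn, fun y hy => ?_, ?_, ?_⟩, h00⟩
    · rw [derivWithin_congr e1 (e1 y hy), (h2 y).hasDerivWithinAt.derivWithin (hu y hy)]
      ring
    · rw [e1 0 (by simp), h10]
    · rw [e1 1 (by simp)]
      have hA := (ode_aux ρ₀ c₂ hr.ne' g g1 (fun y _ => (h1 y).hasDerivWithinAt)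
        (fun y _ => (h2 y).hasDerivWithinAt) h10 1 (by simp)).1
      simp only [mul_one] at hA
      rw [hF] at hA
      have : (g1 1 + β * g 1) * cos ρ₀ = 0 := by linear_combination hA + g 1 * hb
      exact (mul_eq_zero.mp this).resolve_right hcos.ne'
  refine ⟨⟨?_, fun h => (hex h).imp fun g hg => hg.1⟩, fun h => ⟨hex h, ?_⟩⟩
  · rintro ⟨g, hg⟩
    obtain ⟨h1, h2⟩ := sol_aux hg
    have hA := (ode_aux ρ₀ c₂ hr.ne' g _ h1 h2 hg.2.2.1 1 (by simp)).1
    simp only [mul_one] at hA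
    rw [← hA]
    linear_combination cos ρ₀ * hg.2.2.2 - g 1 * hb
  · intro g₁ g₂ hg₁ hg₂ h01 h02 y hy
    obtain ⟨a1, a2⟩ := sol_aux hg₁
    obtain ⟨b1, b2⟩ := sol_aux hg₂
    obtain ⟨hA, hB⟩ := ode_aux ρ₀ c₂ hr.ne' g₁ _ a1 a2 hg₁.2.2.1 y hy
    obtain ⟨hA', hB'⟩ := ode_aux ρ₀ c₂ hr.ne' g₂ _ b1 b2 hg₂.2.2.1 y hy
    rw [h01] at hB
    rw [h02] at hB'
    have hA2 := hA.trans hA'.symm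
    have hB2 := hB.trans hB'.symm
    have : ρ₀ * g₁ y = ρ₀ * g₂ y := by
      linear_combination sin (ρ₀*y) * hA2 - cos (ρ₀*y) * hB2 -
        ρ₀ * (g₁ y - g₂ y) * sin_sq_add_cos_sq (ρ₀*y)
    exact mul_left_cancel₀ hr.ne' this
end
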